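/- arXiv:2311.02771 — 9 statements merged into one kernel-verified Lean document; each statement's English description precedes it below -/
import Mathlib

section
/- Let F_q be a finite field and let A ⊆ F_q \ {0} be a set of size n ≥ 3 such that for any two distinct elements δ, δ′ ∈ A one has δ ≠ −δ′. Let γ be a root of an irreducible polynomial of degree 3 over F_q, so that γ ∈ F_{q^3}. Let (α_1, ..., α_n) be any ordering of the n elements {δ + δ^{-1}·γ : δ ∈ A} ⊆ F_{q^3}. Then the [n,2] Reed–Solomon code over F_{q^3} with evaluation vector (α_1, ..., α_n) can correct any n−3 insertion and deletion errors: for any two distinct polynomials f, g ∈ F_{q^3}[x] of degree less than 2, every common subsequence of (f(α_1), ..., f(α_n)) and (g(α_1), ..., g(α_n)) has length at most 2. -/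
open Polynomial in
/-- A root of an irreducible cubic over `F` satisfies no nontrivial quadratic relation over `F`. -/
theorem Irreducible.quadratic_coeffs_eq_zero_of_degree_eq_three {F K : Type*} [Field F] [Field K]
    [Algebra F K] {P : F[X]} (hP : Irreducible P) (hdeg : P.degree = 3) {γ : K}
    (hγ : aeval γ P = 0) {a b c : F}
    (h : algebraMap F K a * γ ^ 2 + algebraMap F K b * γ + algebraMap F K c = 0) :
    a = 0 ∧ b = 0 ∧ c = 0 := by
  have hQ : aeval γ (C a * X ^ 2 + C b * X + C c) = 0 := by simpa using h
  have hdvd : P ∣ C a * X ^ 2 + C b * X + C c := by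
    by_contra hnd
    obtain ⟨u, v, huv⟩ := (hP.coprime_iff_not_dvd).2 hnd
    simpa [hγ, hQ] using congrArg (aeval γ) huv
  have hzero : C a * X ^ 2 + C b * X + C c = 0 := by
    refine eq_zero_of_dvd_of_degree_lt hdvd ?_
    rw [hdeg]
    exact degree_quadratic_lt
  have hcoeff (k : ℕ) := congrArg (fun Q => coeff Q k) hzero
  exact ⟨by simpa [coeff_X, coeff_C] using hcoeff 2, by simpa [coeff_X, coeff_C] using hcoeff 1,
    by simpa [coeff_X, coeff_C] using hcoeff 0⟩

/-- The map `δ ↦ δ + δ⁻¹ * γ` is injective when `γ` is a root of an irreducible cubic. -/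
theorem Irreducible.add_inv_mul_injective {F K : Type*} [Field F] [Field K]
    [Algebra F K] {P : Polynomial F} (hP : Irreducible P) (hdeg : P.degree = 3) {γ : K}
    (hγ : Polynomial.aeval γ P = 0) :
    Function.Injective fun δ : F => algebraMap F K δ + (algebraMap F K δ)⁻¹ * γ := by
  intro x y hxy
  have h := (hP.quadratic_coeffs_eq_zero_of_degree_eq_three hdeg hγ
    (a := 0) (b := x⁻¹ - y⁻¹) (c := x - y) (by
      simp only [map_zero, map_sub, map_inv₀]
      linear_combination hxy)).2.2
  exact sub_eq_zero.1 h

/-- If two triples of points `δ + δ⁻¹ * γ` are affinely equivalent, with parameters `s` and `t`,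
then the products of the first two parameters agree, and so do the middle ones up to sign. -/
theorem Irreducible.eq_or_eq_neg_of_cross_mul_eq {F K : Type*} [Field F] [Field K]
    [Algebra F K] {P : Polynomial F} (hP : Irreducible P) (hdeg : P.degree = 3) {γ : K}
    (hγ : Polynomial.aeval γ P = 0) {s₁ s₂ s₃ t₁ t₂ t₃ : F}
    (hs₁ : s₁ ≠ 0) (hs₂ : s₂ ≠ 0) (hs₃ : s₃ ≠ 0) (ht₁ : t₁ ≠ 0) (ht₂ : t₂ ≠ 0) (ht₃ : t₃ ≠ 0)
    (hs₁₂ : s₁ ≠ s₂) (hs₁₃ : s₁ ≠ s₃) (ht₂₃ : t₂ ≠ t₃) {x : F → K}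
    (hx : ∀ δ, x δ = algebraMap F K δ + (algebraMap F K δ)⁻¹ * γ)
    (h : (x s₁ - x s₂) * (x t₂ - x t₃) = (x t₁ - x t₂) * (x s₂ - x s₃)) :
    s₁ * s₂ = t₁ * t₂ ∧ (s₂ = t₂ ∨ s₂ = -t₂) := by
  obtain ⟨h₂, h₁, h₀⟩ := hP.quadratic_coeffs_eq_zero_of_degree_eq_three hdeg hγ
    (a := (s₁⁻¹ - s₂⁻¹) * (t₂⁻¹ - t₃⁻¹) - (t₁⁻¹ - t₂⁻¹) * (s₂⁻¹ - s₃⁻¹))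
    (b := (s₁ - s₂) * (t₂⁻¹ - t₃⁻¹) + (s₁⁻¹ - s₂⁻¹) * (t₂ - t₃)
      - ((t₁ - t₂) * (s₂⁻¹ - s₃⁻¹) + (t₁⁻¹ - t₂⁻¹) * (s₂ - s₃)))
    (c := (s₁ - s₂) * (t₂ - t₃) - (t₁ - t₂) * (s₂ - s₃)) (by
      simp only [map_sub, map_add, map_mul, map_inv₀]
      simp only [hx] at h
      linear_combination h)
  have inv_sub {a b : F} (ha : a ≠ 0) (hb : b ≠ 0) : a⁻¹ - b⁻¹ = -((a - b) * (a * b)⁻¹) := by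
    field_simp
    ring
  rw [inv_sub hs₁ hs₂, inv_sub ht₂ ht₃, inv_sub ht₁ ht₂, inv_sub hs₂ hs₃] at h₁ h₂
  have hC : (s₁ - s₂) * (t₂ - t₃) ≠ 0 :=
    mul_ne_zero (sub_ne_zero.2 hs₁₂) (sub_ne_zero.2 ht₂₃)
  have hsum : (t₂ * t₃)⁻¹ + (s₁ * s₂)⁻¹ - ((s₂ * s₃)⁻¹ + (t₁ * t₂)⁻¹) = 0 := by
    refine (mul_eq_zero.1 ?_).resolve_left hC
    linear_combination -h₁ - ((s₂ * s₃)⁻¹ + (t₁ * t₂)⁻¹) * h₀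
  have hprod : (s₁ * s₂)⁻¹ * (t₂ * t₃)⁻¹ - (t₁ * t₂)⁻¹ * (s₂ * s₃)⁻¹ = 0 := by
    refine (mul_eq_zero.1 ?_).resolve_left hC
    linear_combination h₂ - (t₁ * t₂)⁻¹ * (s₂ * s₃)⁻¹ * h₀
  have hne : (s₁ * s₂)⁻¹ - (s₂ * s₃)⁻¹ ≠ 0 := fun h' =>
    hs₁₃ (mul_left_cancel₀ hs₂ (by linear_combination inv_injective (sub_eq_zero.1 h')))
  have hst : (s₁ * s₂)⁻¹ = (t₁ * t₂)⁻¹ := by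
    refine sub_eq_zero.1 ((mul_eq_zero.1 ?_).resolve_right hne)
    linear_combination (s₁ * s₂)⁻¹ * hsum - hprod
  have hst' : t₂ * t₃ = s₂ * s₃ := inv_injective (by linear_combination hsum - hst)
  have hst'' : s₁ * s₂ = t₁ * t₂ := inv_injective hst
  refine ⟨hst'', sq_eq_sq_iff_eq_or_eq_neg.1 (sub_eq_zero.1 <|
    (mul_eq_zero.1 ?_).resolve_left (sub_ne_zero.2 hs₁₃))⟩
  linear_combination -t₂ * h₀ - (s₁ - s₂) * hst' + (s₂ - s₃) * hst''

/-- The entries of a sublist of `List.ofFn u` are values of `u` at distinct positions. -/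
theorem List.exists_injective_of_sublist_ofFn {β : Type*} {n : ℕ} {u : Fin n → β} {s : List β}
    (h : s.Sublist (List.ofFn u)) :
    ∃ i : Fin s.length → Fin n, Function.Injective i ∧ ∀ k, s.get k = u (i k) := by
  obtain ⟨φ, hφ⟩ := List.sublist_iff_exists_fin_orderEmbedding_get_eq.1 h
  exact ⟨fun k => Fin.cast (List.length_ofFn) (φ k),
    (Fin.cast_injective _).comp φ.injective, fun k => (hφ k).trans (List.get_ofFn u _)⟩

/-- Construction over any characteristic: let `A ⊆ F_q \ {0}` with `|A| = n ≥ 3` be such that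
no two distinct elements of `A` are negatives of each other, let `γ ∈ F_{q^3}` be a root of a
degree-3 irreducible polynomial over `F_q`, and let `(α_1, …, α_n)` be any ordering of the `n`
elements `δ + δ⁻¹·γ`, `δ ∈ A`. Then the `[n,2]` Reed–Solomon code over `F_{q^3}` with this
evaluation vector corrects any `n - 3` insdel errors. -/
theorem rs_dim_two_insdel_any_char {F K : Type*} [Field F] [Fintype F] [Field K] [Fintype K]
    [Algebra F K] (hcard : Fintype.card K = Fintype.card F ^ 3)
    (γ : K) (P : Polynomial F) (hPirr : Irreducible P) (hPdeg : P.degree = 3)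
    (hPγ : Polynomial.aeval γ P = 0)
    (n : ℕ) (hn : 3 ≤ n) (A : Finset F) (hAcard : A.card = n) (hA0 : (0 : F) ∉ A)
    (hAneg : ∀ δ ∈ A, ∀ δ' ∈ A, δ ≠ δ' → δ ≠ -δ')
    (e : Fin n → F) (he : Function.Injective e) (heA : ∀ i, e i ∈ A)
    (α : Fin n → K)
    (hα : ∀ i, α i = algebraMap F K (e i) + (algebraMap F K (e i))⁻¹ * γ) :
    ∀ f g : Polynomial K, f.degree < 2 → g.degree < 2 → f ≠ g →
      ∀ s : List K,
        s.Sublist (List.ofFn fun i => f.eval (α i)) →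
        s.Sublist (List.ofFn fun i => g.eval (α i)) →
        s.length ≤ 2 := by
  intro f g hf hg hfg s hsf hsg
  by_contra! hlen
  obtain ⟨i, hi, hfi⟩ := List.exists_injective_of_sublist_ofFn hsf
  obtain ⟨j, hj, hgj⟩ := List.exists_injective_of_sublist_ofFn hsg
  have hαinj : Function.Injective α := fun k l hkl =>
    he (hPirr.add_inv_mul_injective hPdeg hPγ (by simpa only [hα] using hkl))
  have he0 (k) : e k ≠ 0 := fun h => hA0 (h ▸ heA k)
  have key (k) : f.eval (α (i k)) = g.eval (α (j k)) := (hfi k).symm.trans (hgj k)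
  obtain ⟨b, a, rfl⟩ := Polynomial.exists_eq_X_add_C_of_natDegree_le_one
    (Polynomial.natDegree_le_of_degree_le (Order.le_of_lt_succ hf))
  obtain ⟨d, c, rfl⟩ := Polynomial.exists_eq_X_add_C_of_natDegree_le_one
    (Polynomial.natDegree_le_of_degree_le (Order.le_of_lt_succ hg))
  simp only [Polynomial.eval_add, Polynomial.eval_mul, Polynomial.eval_C, Polynomial.eval_X]
    at key
  let k₁ : Fin s.length := ⟨0, by omega⟩
  let k₂ : Fin s.length := ⟨1, by omega⟩
  let k₃ : Fin s.length := ⟨2, by omega⟩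
  have h₁₂ : k₁ ≠ k₂ := by simp [k₁, k₂]
  have h₁₃ : k₁ ≠ k₃ := by simp [k₁, k₃]
  have h₂₃ : k₂ ≠ k₃ := by simp [k₂, k₃]
  have hxj {k l} (h : k ≠ l) : α (j k) - α (j l) ≠ 0 := sub_ne_zero.2 ((hαinj.comp hj).ne h)
  have hdiff (k l) : b * (α (i k) - α (i l)) = d * (α (j k) - α (j l)) := by
    linear_combination key k - key l
  by_cases hb : b = 0
  · have hd : d = 0 := by
      simpa [hb, hxj h₁₂] using (hdiff k₁ k₂).symm
    have hac : a = c := by simpa [hb, hd] using key k₁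
    exact hfg (by rw [hb, hd, hac])
  have hcross : (α (i k₁) - α (i k₂)) * (α (j k₂) - α (j k₃))
      = (α (j k₁) - α (j k₂)) * (α (i k₂) - α (i k₃)) := by
    refine mul_left_cancel₀ hb ?_
    linear_combination (α (j k₂) - α (j k₃)) * hdiff k₁ k₂
      - (α (j k₁) - α (j k₂)) * hdiff k₂ k₃
  simp only [hα] at hcross
  obtain ⟨hprod, hmid⟩ := hPirr.eq_or_eq_neg_of_cross_mul_eq hPdeg hPγ
    (he0 _) (he0 _) (he0 _) (he0 _) (he0 _) (he0 _)
    ((he.comp hi).ne h₁₂) ((he.comp hi).ne h₁₃) ((he.comp hj).ne h₂₃)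
    (x := fun δ => algebraMap F K δ + (algebraMap F K δ)⁻¹ * γ) (fun _ => rfl) hcross
  have h₂ : e (i k₂) = e (j k₂) := by
    by_contra hne
    exact hAneg _ (heA _) _ (heA _) hne (hmid.resolve_left hne)
  have h₁ : e (i k₁) = e (j k₁) := mul_right_cancel₀ (he0 (i k₂)) (by rw [hprod, h₂])
  have hi₁ : i k₁ = j k₁ := he h₁
  have hi₂ : i k₂ = j k₂ := he h₂
  have hbd : b = d := mul_right_cancel₀ (hxj h₁₂) (by simpa only [hi₁, hi₂] using hdiff k₁ k₂)
  have hac : a = c := by simpa [hi₁, hbd] using key k₁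
  exact hfg (by rw [hbd, hac])
end

section
/- Let F_q be a finite field, let A ⊆ F_q \ {0} satisfy that for any two distinct elements δ, δ′ ∈ A one has δ ≠ −δ′, and let γ ∈ F_{q^3} have minimal polynomial of degree 3 over F_q. For δ ∈ A write β(δ) = δ + δ^{-1}·γ ∈ F_{q^3}. Then for any δ_1, ..., δ_6 ∈ A such that δ_1, δ_2, δ_3 are pairwise distinct, δ_4, δ_5, δ_6 are pairwise distinct, and δ_i = δ_{i+3} for at most one index i ∈ {1,2,3}, the 3×3 matrix with rows (1, β(δ_1), β(δ_4)), (1, β(δ_2), β(δ_5)), (1, β(δ_3), β(δ_6)) has nonzero determinant. -/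
/-- An element whose minimal polynomial has degree 3 satisfies no nontrivial quadratic relation. -/
theorem coeffs_eq_zero_of_minpoly_degree_eq_three {F K : Type*} [Field F] [Field K] [Algebra F K]
    {γ : K} (hγ : (minpoly F γ).degree = 3) {p q r : F}
    (h : algebraMap F K p * γ ^ 2 + algebraMap F K q * γ + algebraMap F K r = 0) :
    p = 0 ∧ q = 0 ∧ r = 0 := by
  have hP : Polynomial.C p * Polynomial.X ^ 2 + Polynomial.C q * Polynomial.X +
      Polynomial.C r = 0 := by
    by_contra hne
    have hle := minpoly.degree_le_of_ne_zero F γ hne (by simpa using h)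
    rw [hγ] at hle
    exact absurd (hle.trans Polynomial.degree_quadratic_le) (by decide)
  refine ⟨?_, ?_, ?_⟩
  · simpa using congrArg (Polynomial.coeff · 2) hP
  · simpa [Polynomial.coeff_X, Polynomial.coeff_C] using congrArg (Polynomial.coeff · 1) hP
  · simpa using congrArg (Polynomial.coeff · 0) hP

/-- Comparing the factorizations of both sides of the vanishing `2 × 2` determinant of differences
of values of `δ ↦ δ + δ⁻¹ * γ`, as quadratic polynomials in `γ`. -/
theorem mul_eq_mul_of_sub_mul_sub_eq {F K : Type*} [Field F] [Field K] [Algebra F K]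
    {γ : K} (hγ : (minpoly F γ).degree = 3) {a b c d e f : F}
    (ha : a ≠ 0) (hb : b ≠ 0) (hc : c ≠ 0) (hd : d ≠ 0) (he : e ≠ 0) (hf : f ≠ 0)
    (hab : a ≠ b) (hbc : b ≠ c) (hdf : d ≠ f)
    (h : ((algebraMap F K a + (algebraMap F K a)⁻¹ * γ) -
            (algebraMap F K b + (algebraMap F K b)⁻¹ * γ)) *
          ((algebraMap F K d + (algebraMap F K d)⁻¹ * γ) -
            (algebraMap F K f + (algebraMap F K f)⁻¹ * γ)) =
        ((algebraMap F K a + (algebraMap F K a)⁻¹ * γ) -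
            (algebraMap F K c + (algebraMap F K c)⁻¹ * γ)) *
          ((algebraMap F K d + (algebraMap F K d)⁻¹ * γ) -
            (algebraMap F K e + (algebraMap F K e)⁻¹ * γ))) :
    a * b = d * e ∧ a * c = d * f := by
  have key (x y : F) (hx : x ≠ 0) (hy : y ≠ 0) :
      algebraMap F K x * algebraMap F K y *
        ((algebraMap F K x + (algebraMap F K x)⁻¹ * γ) -
          (algebraMap F K y + (algebraMap F K y)⁻¹ * γ)) =
      (algebraMap F K x - algebraMap F K y) * (algebraMap F K x * algebraMap F K y - γ) := by
    have hx' : algebraMap F K x ≠ 0 := by simpa using hx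
    have hy' : algebraMap F K y ≠ 0 := by simpa using hy
    field_simp
    ring
  have kab := key a b ha hb
  have kdf := key d f hd hf
  have kac := key a c ha hc
  have kde := key d e hd he
  have had : algebraMap F K a * algebraMap F K d ≠ 0 := by simp [ha, hd]
  generalize (algebraMap F K a + (algebraMap F K a)⁻¹ * γ) -
    (algebraMap F K b + (algebraMap F K b)⁻¹ * γ) = s at h kab
  generalize (algebraMap F K d + (algebraMap F K d)⁻¹ * γ) -
    (algebraMap F K f + (algebraMap F K f)⁻¹ * γ) = t at h kdf
  generalize (algebraMap F K a + (algebraMap F K a)⁻¹ * γ) -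
    (algebraMap F K c + (algebraMap F K c)⁻¹ * γ) = u at h kac
  generalize (algebraMap F K d + (algebraMap F K d)⁻¹ * γ) -
    (algebraMap F K e + (algebraMap F K e)⁻¹ * γ) = v at h kde
  obtain ⟨h2, h1, h0⟩ := coeffs_eq_zero_of_minpoly_degree_eq_three hγ
    (p := (a - b) * (d - f) * (c * e) - (a - c) * (d - e) * (b * f))
    (q := -((a - b) * (d - f) * (c * e) * (a * b + d * f)) +
      (a - c) * (d - e) * (b * f) * (a * c + d * e))
    (r := (a - b) * (d - f) * (c * e) * (a * b * (d * f)) -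
      (a - c) * (d - e) * (b * f) * (a * c * (d * e))) (by
      simp only [map_sub, map_add, map_mul, map_neg]
      generalize algebraMap F K a = a' at *
      generalize algebraMap F K b = b' at *
      generalize algebraMap F K c = c' at *
      generalize algebraMap F K d = d' at *
      generalize algebraMap F K e = e' at *
      generalize algebraMap F K f = f' at *
      linear_combination (-(c' * e' * (d' - f') * (d' * f' - γ))) * kab -
        c' * e' * a' * b' * s * kdf + b' * f' * (d' - e') * (d' * e' - γ) * kac +
        b' * f' * a' * c' * u * kde + a' * b' * c' * d' * e' * f' * h)
  have hL : (a - b) * (d - f) * (c * e) ≠ 0 := by simp [sub_ne_zero, *]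
  have hM : (a - c) * (d - e) * (b * f) = (a - b) * (d - f) * (c * e) := by
    linear_combination -h2
  rw [hM] at h1 h0
  have hsum : a * b + d * f = a * c + d * e :=
    mul_left_cancel₀ hL (by linear_combination -h1)
  have hprod : a * b * (d * f) = a * c * (d * e) :=
    mul_left_cancel₀ hL (by linear_combination h0)
  have hfac : (a * b - d * e) * (a * (b - c)) = 0 := by
    linear_combination (a * b) * hsum - hprod
  have hE : a * b = d * e := by
    simpa [ha, sub_eq_zero, hbc] using hfac
  exact ⟨hE, by linear_combination hE - hsum⟩

/-- Core determinant lemma for the any-characteristic construction: with `A ⊆ F_q \ {0}`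
containing no pair of distinct elements that are negatives of each other, `γ ∈ F_{q^3}` having
minimal polynomial of degree 3 over `F_q`, and `β(δ) = δ + δ⁻¹·γ`, for any `δ_1, …, δ_6 ∈ A`
with `δ_1, δ_2, δ_3` pairwise distinct, `δ_4, δ_5, δ_6` pairwise distinct, and `δ_i = δ_{i+3}`
for at most one index `i ∈ {1,2,3}`, the matrix with rows `(1, β(δ_i), β(δ_{i+3}))` has nonzero
determinant. -/
theorem det_ne_zero_any_char_construction {F K : Type*} [Field F] [Fintype F] [Field K]
    [Fintype K] [Algebra F K] (hcard : Fintype.card K = Fintype.card F ^ 3)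
    (γ : K) (hγ : (minpoly F γ).degree = 3)
    (A : Set F) (hA0 : (0 : F) ∉ A)
    (hAneg : ∀ δ ∈ A, ∀ δ' ∈ A, δ ≠ δ' → δ ≠ -δ')
    (δ₁ δ₂ δ₃ δ₄ δ₅ δ₆ : F)
    (h₁ : δ₁ ∈ A) (h₂ : δ₂ ∈ A) (h₃ : δ₃ ∈ A) (h₄ : δ₄ ∈ A) (h₅ : δ₅ ∈ A) (h₆ : δ₆ ∈ A)
    (h₁₂ : δ₁ ≠ δ₂) (h₁₃ : δ₁ ≠ δ₃) (h₂₃ : δ₂ ≠ δ₃)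
    (h₄₅ : δ₄ ≠ δ₅) (h₄₆ : δ₄ ≠ δ₆) (h₅₆ : δ₅ ≠ δ₆)
    (hagree₁ : ¬(δ₁ = δ₄ ∧ δ₂ = δ₅)) (hagree₂ : ¬(δ₁ = δ₄ ∧ δ₃ = δ₆))
    (hagree₃ : ¬(δ₂ = δ₅ ∧ δ₃ = δ₆)) :
    (!![1, algebraMap F K δ₁ + (algebraMap F K δ₁)⁻¹ * γ,
          algebraMap F K δ₄ + (algebraMap F K δ₄)⁻¹ * γ;
        1, algebraMap F K δ₂ + (algebraMap F K δ₂)⁻¹ * γ,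
          algebraMap F K δ₅ + (algebraMap F K δ₅)⁻¹ * γ;
        1, algebraMap F K δ₃ + (algebraMap F K δ₃)⁻¹ * γ,
          algebraMap F K δ₆ + (algebraMap F K δ₆)⁻¹ * γ]).det ≠ 0 := by
  have ne_zero {x : F} (hx : x ∈ A) : x ≠ 0 := fun h => hA0 (h ▸ hx)
  have eq_of_sq {x y : F} (hx : x ∈ A) (hy : y ∈ A) (h : x ^ 2 = y ^ 2) : x = y := by
    by_contra hne
    exact (sq_eq_sq_iff_eq_or_eq_neg.mp h).elim hne (hAneg x hx y hy hne)
  intro hdet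
  simp [Matrix.det_fin_three, -map_inv₀] at hdet
  obtain ⟨h12, h13⟩ := mul_eq_mul_of_sub_mul_sub_eq hγ (ne_zero h₁) (ne_zero h₂) (ne_zero h₃)
    (ne_zero h₄) (ne_zero h₅) (ne_zero h₆) h₁₂ h₂₃ h₄₆ (by linear_combination hdet)
  obtain ⟨-, h23⟩ := mul_eq_mul_of_sub_mul_sub_eq hγ (ne_zero h₂) (ne_zero h₁) (ne_zero h₃)
    (ne_zero h₅) (ne_zero h₄) (ne_zero h₆) h₁₂.symm h₁₃ h₅₆ (by linear_combination -hdet)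
  have h14 : δ₁ = δ₄ := eq_of_sq h₁ h₄
    (mul_right_cancel₀ (mul_ne_zero (ne_zero h₂) (ne_zero h₃))
      (by linear_combination δ₁ * δ₃ * h12 + δ₄ * δ₅ * h13 - δ₄ ^ 2 * h23))
  have h25 : δ₂ = δ₅ := by
    rw [← h14] at h12
    exact mul_left_cancel₀ (ne_zero h₁) h12
  exact hagree₁ ⟨h14, h25⟩
end

section
/- Let F_q be a finite field of characteristic p > 2 and let A ⊆ F_q \ {0} be a subset of size n ≥ 3. Let γ be a root of an irreducible polynomial of degree 3 over F_q, so that γ ∈ F_{q^3}. Let (α_1, ..., α_n) be any ordering of the n elements {δ + δ²·γ : δ ∈ A} ⊆ F_{q^3}. Then the [n,2] Reed–Solomon code over F_{q^3} with evaluation vector (α_1, ..., α_n) can correct any n−3 insertion and deletion errors: for any two distinct polynomials f, g ∈ F_{q^3}[x] of degree less than 2, every common subsequence of (f(α_1), ..., f(α_n)) and (g(α_1), ..., g(α_n)) has length at most 2. -/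
open Polynomial in
/-- Over `F`, the powers `1, γ, γ²` of a root of an irreducible cubic are linearly independent. -/
lemma coeffs_eq_zero_of_irreducible_cubic {F K : Type*} [Field F] [Field K] [Algebra F K]
    {γ : K} {P : F[X]} (hPirr : Irreducible P) (hPdeg : P.degree = 3) (hPγ : aeval γ P = 0)
    {x y z : F}
    (h : algebraMap F K x + algebraMap F K y * γ + algebraMap F K z * γ ^ 2 = 0) :
    x = 0 ∧ y = 0 ∧ z = 0 := by
  have hQ : C z * X ^ 2 + C y * X + C x = 0 := by
    by_contra hne
    have hle := minpoly.degree_le_of_ne_zero F γ hne (by simp; linear_combination h)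
    rw [← minpoly.eq_of_irreducible hPirr hPγ,
      degree_mul_C (inv_ne_zero (leadingCoeff_ne_zero.mpr hPirr.ne_zero)), hPdeg] at hle
    exact absurd (hle.trans degree_quadratic_le) (by decide)
  refine ⟨?_, ?_, ?_⟩
  · simpa using congrArg (coeff · 0) hQ
  · simpa [coeff_X, coeff_C] using congrArg (coeff · 1) hQ
  · simpa [coeff_X, coeff_C] using congrArg (coeff · 2) hQ

/-- Triples on the curve `δ ↦ δ + δ²γ` with the same ratio of consecutive differences coincide. -/
lemma eq_of_curve_ratio_eq {F K : Type*} [Field F] [Field K] [Algebra F K] (h2 : (2 : F) ≠ 0)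
    {γ : K}
    (hγ : ∀ x y z : F, algebraMap F K x + algebraMap F K y * γ + algebraMap F K z * γ ^ 2 = 0 →
      x = 0 ∧ y = 0 ∧ z = 0)
    {φ : F → K} (hφ : ∀ δ, φ δ = algebraMap F K δ + algebraMap F K δ ^ 2 * γ)
    {s₁ s₂ s₃ t₁ t₂ t₃ : F} (hs₁₂ : s₁ ≠ s₂) (hs₁₃ : s₁ ≠ s₃) (ht₂₃ : t₂ ≠ t₃)
    (h : (φ s₁ - φ s₂) * (φ t₂ - φ t₃) = (φ s₂ - φ s₃) * (φ t₁ - φ t₂)) :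
    s₁ = t₁ ∧ s₂ = t₂ ∧ s₃ = t₃ := by
  obtain ⟨e₀, e₁, e₂⟩ := hγ
    ((s₁ - s₂) * (t₂ - t₃) - (s₂ - s₃) * (t₁ - t₂))
    ((s₁ - s₂) * (t₂ - t₃) * ((s₁ + s₂) + (t₂ + t₃)) -
      (s₂ - s₃) * (t₁ - t₂) * ((s₂ + s₃) + (t₁ + t₂)))
    ((s₁ - s₂) * (t₂ - t₃) * ((s₁ + s₂) * (t₂ + t₃)) -
      (s₂ - s₃) * (t₁ - t₂) * ((s₂ + s₃) * (t₁ + t₂)))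
    (by simp only [hφ] at h; simp only [map_sub, map_mul, map_add]; linear_combination h)
  have hN : (s₁ - s₂) * (t₂ - t₃) ≠ 0 := mul_ne_zero (sub_ne_zero.mpr hs₁₂) (sub_ne_zero.mpr ht₂₃)
  have hsum : (s₁ + s₂) + (t₂ + t₃) = (s₂ + s₃) + (t₁ + t₂) := by
    apply mul_left_cancel₀ hN
    linear_combination e₁ - ((s₂ + s₃) + (t₁ + t₂)) * e₀
  have hprod : (s₁ + s₂) * (t₂ + t₃) = (s₂ + s₃) * (t₁ + t₂) := by
    apply mul_left_cancel₀ hN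
    linear_combination e₂ - ((s₂ + s₃) * (t₁ + t₂)) * e₀
  have hA : s₁ + s₂ = t₁ + t₂ := by
    apply sub_eq_zero.mp
    apply (mul_eq_zero.mp _).resolve_left (sub_ne_zero.mpr hs₁₃)
    linear_combination (s₁ + s₂) * hsum - hprod
  have hs : s₂ = t₂ := by
    symm
    apply sub_eq_zero.mp
    apply (mul_eq_zero.mp _).resolve_left (mul_ne_zero h2 (sub_ne_zero.mpr hs₁₃))
    have ht₁ : t₁ = s₁ + s₂ - t₂ := by linear_combination -hA
    have ht₃ : t₃ = s₂ + s₃ - t₂ := by linear_combination hsum - hA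
    rw [ht₁, ht₃] at e₀
    linear_combination e₀
  exact ⟨by linear_combination hA - hs, hs, by linear_combination hA - hsum - hs⟩

/-- A list of length at least three without duplicates contains three distinct members. -/
lemma List.Nodup.exists_three_mem {T : Type*} {s : List T} (hs : s.Nodup) (h : 2 < s.length) :
    ∃ x ∈ s, ∃ y ∈ s, ∃ z ∈ s, x ≠ y ∧ x ≠ z ∧ y ≠ z := by
  match s, h with
  | x :: y :: z :: l, _ =>
    refine ⟨x, by simp, y, by simp, z, by simp, ?_⟩
    simp only [List.nodup_cons, List.mem_cons, not_or] at hs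
    tauto


/-- Construction for odd characteristic: let `F_q` have characteristic `p > 2`, let
`A ⊆ F_q \ {0}` with `|A| = n ≥ 3`, let `γ ∈ F_{q^3}` be a root of a degree-3 irreducible
polynomial over `F_q`, and let `(α_1, …, α_n)` be any ordering of the `n` elements
`δ + δ²·γ`, `δ ∈ A`. Then the `[n,2]` Reed–Solomon code over `F_{q^3}` with this evaluation
vector corrects any `n - 3` insdel errors. -/
theorem rs_dim_two_insdel_odd_char {F K : Type*} [Field F] [Fintype F] [Field K] [Fintype K]
    [Algebra F K] (hcard : Fintype.card K = Fintype.card F ^ 3)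
    (p : ℕ) (hp : p.Prime) (hcharp : CharP F p) (hp2 : 2 < p)
    (γ : K) (P : Polynomial F) (hPirr : Irreducible P) (hPdeg : P.degree = 3)
    (hPγ : Polynomial.aeval γ P = 0)
    (n : ℕ) (hn : 3 ≤ n) (A : Finset F) (hAcard : A.card = n) (hA0 : (0 : F) ∉ A)
    (e : Fin n → F) (he : Function.Injective e) (heA : ∀ i, e i ∈ A)
    (α : Fin n → K)
    (hα : ∀ i, α i = algebraMap F K (e i) + (algebraMap F K (e i)) ^ 2 * γ) :
    ∀ f g : Polynomial K, f.degree < 2 → g.degree < 2 → f ≠ g →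
      ∀ s : List K,
        s.Sublist (List.ofFn fun i => f.eval (α i)) →
        s.Sublist (List.ofFn fun i => g.eval (α i)) →
        s.length ≤ 2 := by
  intro f g hf hg hfg s hsf hsg
  have h2 : (2 : F) ≠ 0 := Ring.two_ne_zero (by rw [ringChar.eq F p]; exact hp2.ne')
  have hγ : ∀ x y z : F, algebraMap F K x + algebraMap F K y * γ + algebraMap F K z * γ ^ 2 = 0 →
      x = 0 ∧ y = 0 ∧ z = 0 := fun _ _ _ => coeffs_eq_zero_of_irreducible_cubic hPirr hPdeg hPγ
  have hα_inj : Function.Injective α := by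
    intro i j hij
    rw [hα, hα] at hij
    have h := (hγ (e i - e j) (e i ^ 2 - e j ^ 2) 0
      (by simp only [map_sub, map_pow, map_zero]; linear_combination hij)).1
    exact he (sub_eq_zero.mp h)
  obtain ⟨a, b, rfl⟩ := Polynomial.exists_eq_X_add_C_of_natDegree_le_one
    (Polynomial.natDegree_le_iff_degree_le.mpr (Order.le_of_lt_succ hf))
  obtain ⟨c, d, rfl⟩ := Polynomial.exists_eq_X_add_C_of_natDegree_le_one
    (Polynomial.natDegree_le_iff_degree_le.mpr (Order.le_of_lt_succ hg))
  simp only [Polynomial.eval_add, Polynomial.eval_mul, Polynomial.eval_C, Polynomial.eval_X]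
    at hsf hsg
  by_contra! hlen
  have hmem : ∀ v ∈ s, ∃ i j, a * α i + b = v ∧ c * α j + d = v := by
    intro v hv
    obtain ⟨i, hi⟩ := List.mem_ofFn.mp (hsf.subset hv)
    obtain ⟨j, hj⟩ := List.mem_ofFn.mp (hsg.subset hv)
    exact ⟨i, j, hi, hj⟩
  have hinj : ∀ u w : K, u ≠ 0 → Function.Injective fun i => u * α i + w := fun u w hu i j hij =>
    hα_inj (mul_left_cancel₀ hu (add_right_cancel hij))
  have hnodup : s.Nodup := by
    by_cases ha : a = 0
    · by_cases hc : c = 0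
      · obtain ⟨v, hv⟩ := List.exists_mem_of_length_pos (by omega : 0 < s.length)
        obtain ⟨i, j, hi, hj⟩ := hmem v hv
        subst ha hc
        have : b = d := by linear_combination hi - hj
        exact absurd (by rw [this]) hfg
      · exact hsg.nodup (List.nodup_ofFn.mpr (hinj c d hc))
    · exact hsf.nodup (List.nodup_ofFn.mpr (hinj a b ha))
  obtain ⟨v₁, hv₁, v₂, hv₂, v₃, hv₃, h₁₂, h₁₃, h₂₃⟩ := hnodup.exists_three_mem hlen
  obtain ⟨i₁, j₁, hi₁, hj₁⟩ := hmem v₁ hv₁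
  obtain ⟨i₂, j₂, hi₂, hj₂⟩ := hmem v₂ hv₂
  obtain ⟨i₃, j₃, hi₃, hj₃⟩ := hmem v₃ hv₃
  have hi₁₂ : i₁ ≠ i₂ := by rintro rfl; exact h₁₂ (hi₁.symm.trans hi₂)
  have hi₁₃ : i₁ ≠ i₃ := by rintro rfl; exact h₁₃ (hi₁.symm.trans hi₃)
  have hj₂₃ : j₂ ≠ j₃ := by rintro rfl; exact h₂₃ (hj₂.symm.trans hj₃)
  have ha : a ≠ 0 := by rintro rfl; exact h₁₂ (by linear_combination hi₂ - hi₁)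
  have hratio : (α i₁ - α i₂) * (α j₂ - α j₃) = (α i₂ - α i₃) * (α j₁ - α j₂) := by
    apply mul_left_cancel₀ ha
    linear_combination (α j₂ - α j₃) * (hi₁ - hi₂ - hj₁ + hj₂)
      - (α j₁ - α j₂) * (hi₂ - hi₃ - hj₂ + hj₃)
  rw [hα i₁, hα i₂, hα i₃, hα j₁, hα j₂, hα j₃] at hratio
  obtain ⟨h₁, h₂, -⟩ := eq_of_curve_ratio_eq h2 hγ
    (φ := fun δ => algebraMap F K δ + algebraMap F K δ ^ 2 * γ) (fun _ => rfl)
    (he.ne hi₁₂) (he.ne hi₁₃) (he.ne hj₂₃) hratio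
  obtain rfl := he h₁
  obtain rfl := he h₂
  have hac : a = c := by
    apply mul_right_cancel₀ (sub_ne_zero.mpr (hα_inj.ne hi₁₂))
    linear_combination hi₁ - hi₂ - hj₁ + hj₂
  have hbd : b = d := by
    subst hac
    linear_combination hi₁ - hj₁
  exact hfg (by rw [hac, hbd])
end

section
/- Let F_q be a finite field of characteristic p > 2, let A ⊆ F_q \ {0}, and let γ ∈ F_{q^3} have minimal polynomial of degree 3 over F_q. For δ ∈ A write β(δ) = δ + δ²·γ ∈ F_{q^3}. Then for any δ_1, ..., δ_6 ∈ A such that δ_1, δ_2, δ_3 are pairwise distinct, δ_4, δ_5, δ_6 are pairwise distinct, and δ_i = δ_{i+3} for at most one index i ∈ {1,2,3}, the 3×3 matrix with rows (1, β(δ_1), β(δ_4)), (1, β(δ_2), β(δ_5)), (1, β(δ_3), β(δ_6)) has nonzero determinant. -/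
open Polynomial in
/-- If the minimal polynomial of `γ` has degree 3, then `1, γ, γ²` are linearly independent. -/
lemma coeffs_eq_zero_of_degree_minpoly_eq_three {F K : Type*} [Field F] [Field K] [Algebra F K]
    {γ : K} (hγ : (minpoly F γ).degree = 3) {u v w : F}
    (h : algebraMap F K u + algebraMap F K v * γ + algebraMap F K w * γ ^ 2 = 0) :
    u = 0 ∧ v = 0 ∧ w = 0 := by
  have hP : (C w * X ^ 2 + C v * X + C u : F[X]) = 0 := by
    by_contra hne
    have hle := minpoly.degree_le_of_ne_zero F γ hne (by simp; linear_combination h)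
    rw [hγ] at hle
    exact absurd (hle.trans degree_quadratic_le) (by decide)
  refine ⟨?_, ?_, ?_⟩
  · simpa [coeff_X, coeff_C] using congrArg (coeff · 0) hP
  · simpa [coeff_X, coeff_C] using congrArg (coeff · 1) hP
  · simpa [coeff_X, coeff_C] using congrArg (coeff · 2) hP

/-- In characteristic different from 2, the vanishing of the three mixed determinants of
`(1, a + a² t, b + b² t)` forces `a₁ = b₁` and `a₂ = b₂` when the `aᵢ` are pairwise distinct
and `b₁ ≠ b₂`. -/
lemma eq_of_mixed_dets_eq_zero {F : Type*} [Field F] (h2 : (2 : F) ≠ 0)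
    {a₁ a₂ a₃ b₁ b₂ b₃ : F} (h₁₂ : a₁ ≠ a₂) (h₁₃ : a₁ ≠ a₃) (h₂₃ : a₂ ≠ a₃) (hb : b₁ ≠ b₂)
    (hu : (a₂ - a₁) * (b₃ - b₁) - (a₃ - a₁) * (b₂ - b₁) = 0)
    (hv : (a₂ - a₁) * (b₃ ^ 2 - b₁ ^ 2) - (a₃ - a₁) * (b₂ ^ 2 - b₁ ^ 2)
      + ((a₂ ^ 2 - a₁ ^ 2) * (b₃ - b₁) - (a₃ ^ 2 - a₁ ^ 2) * (b₂ - b₁)) = 0)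
    (hw : (a₂ ^ 2 - a₁ ^ 2) * (b₃ ^ 2 - b₁ ^ 2) - (a₃ ^ 2 - a₁ ^ 2) * (b₂ ^ 2 - b₁ ^ 2) = 0) :
    a₁ = b₁ ∧ a₂ = b₂ := by
  have ha : a₂ - a₁ ≠ 0 := sub_ne_zero.2 h₁₂.symm
  have hV : (a₂ - a₁) * (a₃ - a₁) * (a₃ - a₂) ≠ 0 :=
    mul_ne_zero (mul_ne_zero ha (sub_ne_zero.2 h₁₃.symm)) (sub_ne_zero.2 h₂₃.symm)
  obtain ⟨m, hm⟩ : ∃ m, b₂ - b₁ = m * (a₂ - a₁) := ⟨_, (div_mul_cancel₀ _ ha).symm⟩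
  obtain ⟨c, rfl⟩ : ∃ c, b₁ = m * a₁ + c := ⟨b₁ - m * a₁, by ring⟩
  obtain rfl : b₂ = m * a₂ + c := by linear_combination hm
  obtain rfl : b₃ = m * a₃ + c := by
    apply mul_left_cancel₀ ha
    linear_combination hu
  have hm0 : m ≠ 0 := by
    rintro rfl
    simp at hb
  have hc : c = 0 := by
    have h : 2 * m * ((a₂ - a₁) * (a₃ - a₁) * (a₃ - a₂)) * c = 0 := by
      linear_combination -hw
    exact (mul_eq_zero.1 h).resolve_left (mul_ne_zero (mul_ne_zero h2 hm0) hV)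
  subst hc
  have hm1 : m - 1 = 0 := by
    have h : m * ((a₂ - a₁) * (a₃ - a₁) * (a₃ - a₂)) * (m - 1) = 0 := by
      linear_combination hv
    exact (mul_eq_zero.1 h).resolve_left (mul_ne_zero hm0 hV)
  obtain rfl : m = 1 := sub_eq_zero.1 hm1
  simp


/-- Core determinant lemma for the odd-characteristic construction: with `F_q` of
characteristic `p > 2`, `A ⊆ F_q \ {0}`, `γ ∈ F_{q^3}` having minimal polynomial of degree 3
over `F_q`, and `β(δ) = δ + δ²·γ`, for any `δ_1, …, δ_6 ∈ A` with `δ_1, δ_2, δ_3` pairwise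
distinct, `δ_4, δ_5, δ_6` pairwise distinct, and `δ_i = δ_{i+3}` for at most one index
`i ∈ {1,2,3}`, the matrix with rows `(1, β(δ_i), β(δ_{i+3}))` has nonzero determinant. -/
theorem det_ne_zero_odd_char_construction {F K : Type*} [Field F] [Fintype F] [Field K]
    [Fintype K] [Algebra F K] (hcard : Fintype.card K = Fintype.card F ^ 3)
    (p : ℕ) (hp : p.Prime) (hcharp : CharP F p) (hp2 : 2 < p)
    (γ : K) (hγ : (minpoly F γ).degree = 3)
    (A : Set F) (hA0 : (0 : F) ∉ A)
    (δ₁ δ₂ δ₃ δ₄ δ₅ δ₆ : F)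
    (h₁ : δ₁ ∈ A) (h₂ : δ₂ ∈ A) (h₃ : δ₃ ∈ A) (h₄ : δ₄ ∈ A) (h₅ : δ₅ ∈ A) (h₆ : δ₆ ∈ A)
    (h₁₂ : δ₁ ≠ δ₂) (h₁₃ : δ₁ ≠ δ₃) (h₂₃ : δ₂ ≠ δ₃)
    (h₄₅ : δ₄ ≠ δ₅) (h₄₆ : δ₄ ≠ δ₆) (h₅₆ : δ₅ ≠ δ₆)
    (hagree₁ : ¬(δ₁ = δ₄ ∧ δ₂ = δ₅)) (hagree₂ : ¬(δ₁ = δ₄ ∧ δ₃ = δ₆))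
    (hagree₃ : ¬(δ₂ = δ₅ ∧ δ₃ = δ₆)) :
    (!![1, algebraMap F K δ₁ + (algebraMap F K δ₁) ^ 2 * γ,
          algebraMap F K δ₄ + (algebraMap F K δ₄) ^ 2 * γ;
        1, algebraMap F K δ₂ + (algebraMap F K δ₂) ^ 2 * γ,
          algebraMap F K δ₅ + (algebraMap F K δ₅) ^ 2 * γ;
        1, algebraMap F K δ₃ + (algebraMap F K δ₃) ^ 2 * γ,
          algebraMap F K δ₆ + (algebraMap F K δ₆) ^ 2 * γ]).det ≠ 0 := by
  intro hdet
  have h2 : (2 : F) ≠ 0 := by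
    refine Ring.two_ne_zero ?_
    rw [ringChar.eq F p]
    exact hp2.ne'
  rw [Matrix.det_fin_three] at hdet
  obtain ⟨hu, hv, hw⟩ := coeffs_eq_zero_of_degree_minpoly_eq_three hγ
    (u := (δ₂ - δ₁) * (δ₆ - δ₄) - (δ₃ - δ₁) * (δ₅ - δ₄))
    (v := (δ₂ - δ₁) * (δ₆ ^ 2 - δ₄ ^ 2) - (δ₃ - δ₁) * (δ₅ ^ 2 - δ₄ ^ 2)
      + ((δ₂ ^ 2 - δ₁ ^ 2) * (δ₆ - δ₄) - (δ₃ ^ 2 - δ₁ ^ 2) * (δ₅ - δ₄)))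
    (w := (δ₂ ^ 2 - δ₁ ^ 2) * (δ₆ ^ 2 - δ₄ ^ 2) - (δ₃ ^ 2 - δ₁ ^ 2) * (δ₅ ^ 2 - δ₄ ^ 2))
    (by
      simp at hdet
      simp only [map_sub, map_add, map_mul, map_pow]
      linear_combination hdet)
  exact hagree₁ (eq_of_mixed_dets_eq_zero h2 h₁₂ h₁₃ h₂₃ h₄₅ hu hv hw)
end

section
/- Let α_1, ..., α_n be n distinct elements of a finite field F_q and let k ≤ n. Suppose that for every two strictly increasing index vectors I, J ∈ [n]^{2k−1} that agree on at most k−1 coordinates, the (2k−1)×(2k−1) matrix V_{I,J}(α) whose i-th row is (1, α_{I_i}, α_{I_i}², ..., α_{I_i}^{k−1}, α_{J_i}, α_{J_i}², ..., α_{J_i}^{k−1}) has nonzero determinant. Then the [n,k]_q Reed–Solomon code with evaluation vector (α_1, ..., α_n) can correct any n−2k+1 insertion and deletion errors; that is, for any two polynomials f ≠ g over F_q of degree less than k, every common subsequence of the codewords (f(α_1), ..., f(α_n)) and (g(α_1), ..., g(α_n)) has length at most 2k−2. -/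
/-- A common subsequence of two words yields strictly increasing positions in each. -/
theorem List.Sublist.exists_strictMono_ofFn {β : Type*} {n r : ℕ} {u : Fin n → β} {s : List β}
    (h : s.Sublist (List.ofFn u)) (hr : r ≤ s.length) :
    ∃ I : Fin r → Fin n, StrictMono I ∧ ∀ i, s.get (Fin.castLE hr i) = u (I i) := by
  obtain ⟨e, he⟩ := List.sublist_iff_exists_fin_orderEmbedding_get_eq.1 h
  refine ⟨fun i => Fin.cast (List.length_ofFn) (e (Fin.castLE hr i)), ?_, fun i => ?_⟩
  · intro a b hab
    have : e (Fin.castLE hr a) < e (Fin.castLE hr b) := e.strictMono hab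
    exact this
  · rw [he, List.get_ofFn]

/-- Two polynomials of degree less than `k` that agree at `k` of the points of an injective
family are equal. -/
theorem Polynomial.eq_of_degree_lt_of_eval_eq {F ι : Type*} [Field F] {k : ℕ}
    {f g : Polynomial F} (hf : f.degree < k) (hg : g.degree < k) {x : ι → F}
    (hx : Function.Injective x) {A : Finset ι} (hA : k ≤ A.card)
    (h : ∀ i ∈ A, f.eval (x i) = g.eval (x i)) : f = g := by
  have hA' : (k : WithBot ℕ) ≤ A.card := by exact_mod_cast hA
  exact Polynomial.eq_of_degrees_lt_of_eval_index_eq A hx.injOn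
    (hf.trans_le hA') (hg.trans_le hA') h

/-- Evaluation of a polynomial of degree at most `m`, with the constant term separated. -/
theorem Polynomial.eval_eq_coeff_zero_add_sum {F : Type*} [Field F] {m : ℕ}
    {f : Polynomial F} (hf : f.degree < (m + 1 : ℕ)) (x : F) :
    f.eval x = f.coeff 0 + ∑ j ∈ Finset.range m, f.coeff (j + 1) * x ^ (j + 1) := by
  have hd : f.natDegree < m + 1 := by
    rcases eq_or_ne f 0 with rfl | h0
    · simp
    · exact (Polynomial.natDegree_lt_iff_degree_lt h0).2 hf
  rw [Polynomial.eval_eq_sum_range' hd, Finset.sum_range_succ']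
  simp [add_comm]

/-- The coefficients of `f` and `-g`, with the two constant terms merged into `f₀ - g₀`. -/
noncomputable def mergedCoeff {F : Type*} [Field F] (k : ℕ) (f g : Polynomial F) (j : ℕ) : F :=
  if j = 0 then f.coeff 0 - g.coeff 0
  else if j < k then f.coeff j
  else -g.coeff (j - k + 1)

theorem sum_mul_mergedCoeff {F : Type*} [Field F] {k : ℕ} (hk : 0 < k) {f g : Polynomial F}
    (hf : f.degree < k) (hg : g.degree < k) (x y : F) :
    ∑ j : Fin (2 * k - 1),
      (if (j : ℕ) = 0 then (1 : F)
        else if (j : ℕ) < k then x ^ (j : ℕ)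
        else y ^ ((j : ℕ) - k + 1)) * mergedCoeff k f g j = f.eval x - g.eval y := by
  obtain ⟨m, rfl⟩ : ∃ m, k = m + 1 := ⟨k - 1, by omega⟩
  rw [Fin.sum_univ_eq_sum_range (fun j => (if j = 0 then (1 : F)
        else if j < m + 1 then x ^ j
        else y ^ (j - (m + 1) + 1)) * mergedCoeff (m + 1) f g j),
    show 2 * (m + 1) - 1 = (m + 1) + m by omega, Finset.sum_range_add, Finset.sum_range_succ',
    Polynomial.eval_eq_coeff_zero_add_sum hf, Polynomial.eval_eq_coeff_zero_add_sum hg]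
  have h₁ : ∀ j ∈ Finset.range m, (if j + 1 = 0 then (1 : F)
        else if j + 1 < m + 1 then x ^ (j + 1)
        else y ^ (j + 1 - (m + 1) + 1)) * mergedCoeff (m + 1) f g (j + 1)
      = f.coeff (j + 1) * x ^ (j + 1) := by
    intro j hj
    have hj' : j < m := Finset.mem_range.1 hj
    simp [mergedCoeff, hj', mul_comm]
  have h₂ : ∀ j ∈ Finset.range m, (if m + 1 + j = 0 then (1 : F)
        else if m + 1 + j < m + 1 then x ^ (m + 1 + j)
        else y ^ (m + 1 + j - (m + 1) + 1)) * mergedCoeff (m + 1) f g (m + 1 + j)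
      = -(g.coeff (j + 1) * y ^ (j + 1)) := by
    intro j _
    have hj : ¬ m + 1 + j ≤ m := by omega
    simp [mergedCoeff, hj, mul_comm]
  rw [Finset.sum_congr rfl h₁, Finset.sum_congr rfl h₂, Finset.sum_neg_distrib]
  simp only [mergedCoeff, if_true]
  ring

theorem eq_of_mergedCoeff_eq_zero {F : Type*} [Field F] {k : ℕ} (hk : 0 < k)
    {f g : Polynomial F} (hf : f.degree < k) (hg : g.degree < k)
    (h : ∀ j < 2 * k - 1, mergedCoeff k f g j = 0) : f = g := by
  ext j
  rcases Nat.eq_zero_or_pos j with rfl | hj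
  · have := h 0 (by omega)
    simpa [mergedCoeff, sub_eq_zero] using this
  rcases lt_or_ge j k with hjk | hjk
  · have h₁ := h j (by omega)
    have h₂ := h (j + k - 1) (by omega)
    rw [mergedCoeff, if_neg (by omega), if_pos hjk] at h₁
    rw [mergedCoeff, if_neg (by omega), if_neg (by omega),
      show j + k - 1 - k + 1 = j by omega, neg_eq_zero] at h₂
    rw [h₁, h₂]
  · have hkj : (k : WithBot ℕ) ≤ j := by exact_mod_cast hjk
    rw [Polynomial.coeff_eq_zero_of_degree_lt (hf.trans_le hkj),
      Polynomial.coeff_eq_zero_of_degree_lt (hg.trans_le hkj)]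


/-- Sufficient algebraic condition for an `[n,k]_q` Reed–Solomon code to correct
`n - 2k + 1` insdel errors: if for every pair of strictly increasing index vectors
`I, J ∈ [n]^{2k-1}` agreeing on at most `k - 1` coordinates the matrix `V_{I,J}(α)`,
whose `i`-th row is `(1, α_{I_i}, …, α_{I_i}^{k-1}, α_{J_i}, …, α_{J_i}^{k-1})`, has
nonzero determinant, then any two distinct codewords have no common subsequence of
length greater than `2k - 2`. -/
theorem rs_insdel_sufficient_condition {F : Type*} [Field F] [Fintype F]
    (n k : ℕ) (hkn : k ≤ n) (α : Fin n → F) (hα : Function.Injective α)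
    (hdet : ∀ I J : Fin (2 * k - 1) → Fin n, StrictMono I → StrictMono J →
      (Finset.univ.filter fun i => I i = J i).card ≤ k - 1 →
      (Matrix.of fun i j : Fin (2 * k - 1) =>
        if (j : ℕ) = 0 then (1 : F)
        else if (j : ℕ) < k then α (I i) ^ (j : ℕ)
        else α (J i) ^ ((j : ℕ) - k + 1)).det ≠ 0) :
    ∀ f g : Polynomial F, f.degree < k → g.degree < k → f ≠ g →
      ∀ s : List F,
        s.Sublist (List.ofFn fun i => f.eval (α i)) →
        s.Sublist (List.ofFn fun i => g.eval (α i)) →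
        s.length ≤ 2 * k - 2 := by
  intro f g hf hg hfg s hsf hsg
  by_contra! hlen
  have hk : 0 < k := by
    rcases Nat.eq_zero_or_pos k with rfl | hk
    · refine absurd ?_ hfg
      exact Polynomial.eq_of_degree_lt_of_eval_eq hf hg hα (A := ∅) le_rfl (by simp)
    · exact hk
  have hr : 2 * k - 1 ≤ s.length := by omega
  obtain ⟨I, hI, hIf⟩ := hsf.exists_strictMono_ofFn hr
  obtain ⟨J, hJ, hJg⟩ := hsg.exists_strictMono_ofFn hr
  have hIJ : ∀ i, f.eval (α (I i)) = g.eval (α (J i)) := fun i => (hIf i).symm.trans (hJg i)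
  have hagree : (Finset.univ.filter fun i => I i = J i).card ≤ k - 1 := by
    by_contra! hcard
    refine hfg (Polynomial.eq_of_degree_lt_of_eval_eq hf hg (hα.comp hI.injective)
      (Nat.le_of_pred_lt hcard) fun i hi => ?_)
    have hi' : I i = J i := (Finset.mem_filter.1 hi).2
    simpa [hi'] using hIJ i
  have hzero := Matrix.eq_zero_of_mulVec_eq_zero (hdet I J hI hJ hagree)
    (v := fun j => mergedCoeff k f g j) (by
      funext i
      exact (sum_mul_mergedCoeff hk hf hg (α (I i)) (α (J i))).trans (sub_eq_zero.2 (hIJ i)))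
  exact hfg (eq_of_mergedCoeff_eq_zero hk hf hg fun j hj => congrFun hzero ⟨j, hj⟩)
end

section
/- Let α_1, ..., α_n be n distinct elements of a finite field F_q and let k ≤ n. Suppose the [n,k]_q Reed–Solomon code with evaluation vector (α_1, ..., α_n) can correct any n−2k+1 insertion and deletion errors (i.e., for any two distinct polynomials f, g of degree less than k, every common subsequence of the codewords (f(α_1), ..., f(α_n)) and (g(α_1), ..., g(α_n)) has length at most 2k−2). Then for every two strictly increasing index vectors I, J ∈ [n]^{2k−1} that agree on at most k−1 coordinates, every vector v in the kernel of the (2k−1)×(2k−1) matrix V_{I,J}(α) is of the form v = (0, f_1, ..., f_{k−1}, −f_1, ..., −f_{k−1}) for some f_1, ..., f_{k−1} ∈ F_q. -/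
theorem List.ofFn_comp_sublist_of_strictMono {β : Type*} {m n : ℕ} (h : Fin n → β)
    {I : Fin m → Fin n} (hI : StrictMono I) :
    (List.ofFn fun i => h (I i)).Sublist (List.ofFn h) := by
  rw [List.sublist_iff_exists_fin_orderEmbedding_get_eq]
  refine ⟨OrderEmbedding.ofStrictMono
    (fun i => Fin.cast List.length_ofFn.symm (I (Fin.cast List.length_ofFn i))) ?_, ?_⟩
  · exact fun a b hab => hI hab
  · intro i
    simp only [List.get_ofFn]
    rfl


/-- Necessary condition: if the `[n,k]_q` Reed–Solomon code with evaluation vector `α`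
corrects any `n - 2k + 1` insdel errors, then for every pair of strictly increasing index
vectors `I, J ∈ [n]^{2k-1}` agreeing on at most `k - 1` coordinates, every vector in the
kernel of `V_{I,J}(α)` has the form `(0, f_1, …, f_{k-1}, -f_1, …, -f_{k-1})`. -/
theorem rs_insdel_necessary_condition {F : Type*} [Field F] [Fintype F]
    (n k : ℕ) (hk : 1 ≤ k) (hkn : k ≤ n) (α : Fin n → F) (hα : Function.Injective α)
    (hcode : ∀ f g : Polynomial F, f.degree < k → g.degree < k → f ≠ g →
      ∀ s : List F,
        s.Sublist (List.ofFn fun i => f.eval (α i)) →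
        s.Sublist (List.ofFn fun i => g.eval (α i)) →
        s.length ≤ 2 * k - 2) :
    ∀ I J : Fin (2 * k - 1) → Fin n, StrictMono I → StrictMono J →
      (Finset.univ.filter fun i => I i = J i).card ≤ k - 1 →
      ∀ v : Fin (2 * k - 1) → F,
        (Matrix.of fun i j : Fin (2 * k - 1) =>
          if (j : ℕ) = 0 then (1 : F)
          else if (j : ℕ) < k then α (I i) ^ (j : ℕ)
          else α (J i) ^ ((j : ℕ) - k + 1)).mulVec v = 0 →
        ∃ c : Fin (k - 1) → F,
          v ⟨0, by omega⟩ = 0 ∧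
          ∀ (j : ℕ) (hj : j < k - 1),
            v ⟨1 + j, by omega⟩ = c ⟨j, hj⟩ ∧ v ⟨k + j, by omega⟩ = -c ⟨j, hj⟩ := by
  intro I J hI hJ _ v hv
  set f : Polynomial F := ∑ j : Fin (2 * k - 1),
    if (j : ℕ) < k then Polynomial.monomial (j : ℕ) (v j) else 0 with hf
  set g : Polynomial F := ∑ j : Fin (2 * k - 1),
    if (j : ℕ) < k then 0 else Polynomial.monomial ((j : ℕ) - k + 1) (-v j) with hg
  have hfdeg : f.degree < k := by
    rw [← Polynomial.mem_degreeLT]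
    refine Submodule.sum_mem _ fun j _ => ?_
    split_ifs with h
    · rw [Polynomial.mem_degreeLT]
      exact (Polynomial.degree_monomial_le _ _).trans_lt (by exact_mod_cast h)
    · exact Submodule.zero_mem _
  have hgdeg : g.degree < k := by
    rw [← Polynomial.mem_degreeLT]
    refine Submodule.sum_mem _ fun j _ => ?_
    split_ifs with h
    · exact Submodule.zero_mem _
    · rw [Polynomial.mem_degreeLT]
      refine (Polynomial.degree_monomial_le _ _).trans_lt ?_
      have hlt : (j : ℕ) - k + 1 < k := by omega
      exact_mod_cast hlt
  have heval : ∀ i, f.eval (α (I i)) = g.eval (α (J i)) := by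
    intro i
    refine sub_eq_zero.mp (Eq.trans ?_ (congrFun hv i))
    rw [hf, hg]
    simp only [Polynomial.eval_finsetSum, ← Finset.sum_sub_distrib, Matrix.mulVec, dotProduct,
      Matrix.of_apply]
    refine Finset.sum_congr rfl fun j _ => ?_
    by_cases h0 : (j : ℕ) = 0
    · simp [h0, show 0 < k from hk]
    · by_cases h : (j : ℕ) < k <;> simp [h0, h, mul_comm]
  have hfg : f = g := by
    by_contra hne
    have hlen := hcode f g hfdeg hgdeg hne (List.ofFn fun i => f.eval (α (I i)))
      (List.ofFn_comp_sublist_of_strictMono (fun i => f.eval (α i)) hI)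
      (by simpa only [heval] using
        List.ofFn_comp_sublist_of_strictMono (fun i => g.eval (α i)) hJ)
    rw [List.length_ofFn] at hlen
    omega
  have hfcoeff : ∀ m (hm : m < k), f.coeff m = v ⟨m, by omega⟩ := by
    intro m hm
    rw [hf, Polynomial.finsetSum_coeff, Finset.sum_eq_single ⟨m, by omega⟩]
    · simp [hm]
    · intro j _ hj
      have hjm : (j : ℕ) ≠ m := fun h => hj (Fin.ext h)
      split_ifs <;> simp [Polynomial.coeff_monomial, hjm]
    · simp
  have hgzero : g.coeff 0 = 0 := by
    rw [hg, Polynomial.finsetSum_coeff]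
    refine Finset.sum_eq_zero fun j _ => ?_
    split_ifs <;> simp [Polynomial.coeff_monomial]
  have hgcoeff : ∀ m (hm : m < k - 1), g.coeff (1 + m) = -v ⟨k + m, by omega⟩ := by
    intro m hm
    rw [hg, Polynomial.finsetSum_coeff, Finset.sum_eq_single ⟨k + m, by omega⟩]
    · simp [add_comm]
    · intro j _ hj
      have hjm : (j : ℕ) ≠ k + m := fun h => hj (Fin.ext h)
      split_ifs with h
      · simp
      · rw [Polynomial.coeff_monomial, if_neg (by omega)]
    · simp
  refine ⟨fun j => v ⟨1 + j, by omega⟩, ?_, fun j hj => ⟨rfl, ?_⟩⟩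
  · rw [← hfcoeff 0 hk, hfg, hgzero]
  · change _ = -v ⟨1 + j, _⟩
    rw [← hfcoeff (1 + j) (by omega), hfg, hgcoeff j hj, neg_neg]
end

section
/- Let n ≥ 3 and let α_1, ..., α_n be n distinct elements of a finite field F_q such that the [n,2]_q Reed–Solomon code with evaluation vector (α_1, ..., α_n) can correct any n−3 insertion and deletion errors (i.e., for any two distinct polynomials f, g over F_q of degree less than 2, every common subsequence of the codewords (f(α_1), ..., f(α_n)) and (g(α_1), ..., g(α_n)) has length at most 2). Then q ≥ C(n,3) − 1, where C(n,3) = n(n−1)(n−2)/6 is the binomial coefficient. -/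
/-- Selecting entries along an order embedding of index sets yields a sublist. -/
theorem List.ofFn_comp_orderEmbedding_sublist {β : Type*} {m n : ℕ} (f : Fin n → β)
    (e : Fin m ↪o Fin n) : (List.ofFn fun i => f (e i)).Sublist (List.ofFn f) := by
  rw [List.sublist_iff_exists_fin_orderEmbedding_get_eq]
  refine ⟨((Fin.castOrderIso List.length_ofFn).toOrderEmbedding.trans e).trans
    (Fin.castOrderIso List.length_ofFn.symm).toOrderEmbedding, fun i => ?_⟩
  simp [Fin.cast]

/-- Triples with equal affine ratios and distinct first two points are related by a
polynomial of degree less than two. -/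
theorem exists_degree_lt_two_eval_eq {F : Type*} [Field F] {x₀ x₁ x₂ y₀ y₁ y₂ : F}
    (hx : x₀ ≠ x₁) (hy : y₀ ≠ y₁) (h : (x₂ - x₀) / (x₁ - x₀) = (y₂ - y₀) / (y₁ - y₀)) :
    ∃ f : Polynomial F, f.degree < 2 ∧ f.eval x₀ = y₀ ∧ f.eval x₁ = y₁ ∧ f.eval x₂ = y₂ := by
  have hx' : x₁ - x₀ ≠ 0 := sub_ne_zero.mpr hx.symm
  have hy' : y₁ - y₀ ≠ 0 := sub_ne_zero.mpr hy.symm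
  obtain ⟨a, ha⟩ : ∃ a, a * (x₁ - x₀) = y₁ - y₀ :=
    ⟨(y₁ - y₀) / (x₁ - x₀), div_mul_cancel₀ _ hx'⟩
  have h2 : a * (x₂ - x₀) = y₂ - y₀ := by
    rw [div_eq_div_iff hx' hy', ← ha] at h
    exact mul_right_cancel₀ hx' (by linear_combination h)
  refine ⟨Polynomial.C a * Polynomial.X + Polynomial.C (y₀ - a * x₀),
    Polynomial.degree_linear_lt, ?_⟩
  simp only [Polynomial.eval_add, Polynomial.eval_mul, Polynomial.eval_C, Polynomial.eval_X]
  refine ⟨?_, ?_, ?_⟩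
  · ring
  · linear_combination ha
  · linear_combination h2

/-- Lower bound on the field size: if the `[n,2]_q` Reed–Solomon code with evaluation
vector `(α_1, …, α_n)` corrects any `n - 3` insdel errors, then `q ≥ C(n,3) - 1`. -/
theorem rs_dim_two_field_size_lower_bound {F : Type*} [Field F] [Fintype F]
    (n : ℕ) (hn : 3 ≤ n) (α : Fin n → F) (hα : Function.Injective α)
    (hcorr : ∀ f g : Polynomial F, f.degree < 2 → g.degree < 2 → f ≠ g →
      ∀ s : List F,
        s.Sublist (List.ofFn fun i => f.eval (α i)) →
        s.Sublist (List.ofFn fun i => g.eval (α i)) →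
        s.length ≤ 2) :
    n.choose 3 - 1 ≤ Fintype.card F := by
  let r (e : Fin 3 ↪o Fin n) : F := (α (e 2) - α (e 0)) / (α (e 1) - α (e 0))
  have hne (e : Fin 3 ↪o Fin n) : α (e 0) ≠ α (e 1) := fun h => by
    simpa using e.injective (hα h)
  have hr : Function.Injective r := fun e e' h => by
    obtain ⟨f, hf, hfe⟩ := exists_degree_lt_two_eval_eq (hne e) (hne e') h
    replace hfe : ∀ i, f.eval (α (e i)) = α (e' i) := by
      simpa [Fin.forall_fin_succ] using hfe
    by_cases hX : f = .X
    · subst hX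
      ext i : 1
      exact hα (by simpa using hfe i)
    · have hlen := hcorr f .X hf (Polynomial.degree_X_le.trans_lt (by norm_num)) hX
        (List.ofFn fun i => α (e' i))
        (by simpa only [hfe] using
          List.ofFn_comp_orderEmbedding_sublist (fun i => f.eval (α i)) e)
        (by simpa only [Polynomial.eval_X] using List.ofFn_comp_orderEmbedding_sublist α e')
      simp at hlen
  let g (s : Set.powersetCard (Fin n) 3) : Fin 3 ↪o Fin n := s.1.orderEmbOfFin s.2
  have hg : Function.Injective g := fun s t h => Subtype.ext <| by
    rw [← Finset.coe_inj, ← Finset.range_orderEmbOfFin s.1 s.2,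
      ← Finset.range_orderEmbOfFin t.1 t.2]
    exact congrArg (fun e : Fin 3 ↪o Fin n => Set.range e) h
  have hcard := Nat.card_le_card_of_injective (r ∘ g) (hr.comp hg)
  rw [Set.powersetCard.card, Nat.card_fin, Nat.card_eq_fintype_card] at hcard
  omega
end

section
/- Let F be a field and let δ_1, ..., δ_6 ∈ F be nonzero elements such that δ_1, δ_2, δ_3 are pairwise distinct and δ_4, δ_5, δ_6 are pairwise distinct. Suppose the following three equations hold: (i) (δ_1 − δ_2)(δ_5 − δ_6) = (δ_2 − δ_3)(δ_4 − δ_5); (ii) (δ_1 − δ_2)(δ_5 − δ_6)·(−(δ_1δ_2)^{-1} − (δ_5δ_6)^{-1}) = (δ_2 − δ_3)(δ_4 − δ_5)·(−(δ_2δ_3)^{-1} − (δ_4δ_5)^{-1}); (iii) (δ_1δ_2δ_5δ_6)^{-1}(δ_1 − δ_2)(δ_5 − δ_6) = (δ_2δ_3δ_4δ_5)^{-1}(δ_2 − δ_3)(δ_4 − δ_5). Then either (δ_2 = δ_5 and {δ_1, δ_6} = {δ_3, δ_4} as sets), or {δ_1, −δ_6} = {δ_3, −δ_4} as sets. -/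
/-- In a domain, an unordered pair is determined by its sum and product. -/
theorem Set.pair_eq_pair_of_add_eq_add_of_mul_eq_mul {R : Type*} [CommRing R] [NoZeroDivisors R]
    {a b c d : R} (hadd : a + b = c + d) (hmul : a * b = c * d) : ({a, b} : Set R) = {c, d} := by
  have h : (a - c) * (a - d) = 0 := by linear_combination a * hadd - hmul
  rw [Set.pair_eq_pair_iff]
  rcases mul_eq_zero.mp h with h | h
  · exact Or.inl ⟨by linear_combination h, by linear_combination hadd - h⟩
  · exact Or.inr ⟨by linear_combination h, by linear_combination hadd - h⟩

/-- Core algebraic lemma for the construction with evaluation points `δ + δ⁻¹γ`: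
if the three coefficient equations hold, then either `δ_2 = δ_5` and
`{δ_1, δ_6} = {δ_3, δ_4}`, or `{δ_1, -δ_6} = {δ_3, -δ_4}`. -/
theorem inverse_construction_algebraic_lemma {F : Type*} [Field F]
    (δ₁ δ₂ δ₃ δ₄ δ₅ δ₆ : F)
    (h₁ : δ₁ ≠ 0) (h₂ : δ₂ ≠ 0) (h₃ : δ₃ ≠ 0) (h₄ : δ₄ ≠ 0) (h₅ : δ₅ ≠ 0) (h₆ : δ₆ ≠ 0)
    (h₁₂ : δ₁ ≠ δ₂) (h₁₃ : δ₁ ≠ δ₃) (h₂₃ : δ₂ ≠ δ₃)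
    (h₄₅ : δ₄ ≠ δ₅) (h₄₆ : δ₄ ≠ δ₆) (h₅₆ : δ₅ ≠ δ₆)
    (e₀ : (δ₁ - δ₂) * (δ₅ - δ₆) = (δ₂ - δ₃) * (δ₄ - δ₅))
    (e₁ : (δ₁ - δ₂) * (δ₅ - δ₆) * (-(δ₁ * δ₂)⁻¹ - (δ₅ * δ₆)⁻¹)
        = (δ₂ - δ₃) * (δ₄ - δ₅) * (-(δ₂ * δ₃)⁻¹ - (δ₄ * δ₅)⁻¹))
    (e₂ : (δ₁ * δ₂ * δ₅ * δ₆)⁻¹ * ((δ₁ - δ₂) * (δ₅ - δ₆))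
        = (δ₂ * δ₃ * δ₄ * δ₅)⁻¹ * ((δ₂ - δ₃) * (δ₄ - δ₅))) :
    (δ₂ = δ₅ ∧ ({δ₁, δ₆} : Set F) = {δ₃, δ₄}) ∨ ({δ₁, -δ₆} : Set F) = {δ₃, -δ₄} := by
  have hne : (δ₁ - δ₂) * (δ₅ - δ₆) ≠ 0 :=
    mul_ne_zero (sub_ne_zero.mpr h₁₂) (sub_ne_zero.mpr h₅₆)
  rw [← e₀] at e₁ e₂
  have hinv := mul_left_cancel₀ hne e₁
  have hprod : δ₁ * δ₆ = δ₃ * δ₄ := by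
    have h := inv_injective (mul_right_cancel₀ hne e₂)
    exact mul_left_cancel₀ (mul_ne_zero h₂ h₅) (by linear_combination h)
  have hsum : δ₅ * δ₆ + δ₁ * δ₂ = δ₄ * δ₅ + δ₂ * δ₃ := by
    have hl : δ₁ * δ₆ * (δ₂ * δ₅) * (-(δ₁ * δ₂)⁻¹ - (δ₅ * δ₆)⁻¹) = -(δ₅ * δ₆ + δ₁ * δ₂) := by
      field_simp
      ring
    have hr : δ₃ * δ₄ * (δ₂ * δ₅) * (-(δ₂ * δ₃)⁻¹ - (δ₄ * δ₅)⁻¹) = -(δ₄ * δ₅ + δ₂ * δ₃) := by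
      field_simp
      ring
    rw [hinv, hprod, hr] at hl
    exact (neg_injective hl).symm
  have hdiff : δ₅ * (δ₁ - δ₃) = δ₂ * (δ₄ - δ₆) := by linear_combination e₀ + hprod
  have hsq : δ₂ ^ 2 = δ₅ ^ 2 :=
    mul_right_cancel₀ (sub_ne_zero.mpr h₁₃) (by linear_combination δ₂ * hsum - δ₅ * hdiff)
  rcases sq_eq_sq_iff_eq_or_eq_neg.mp hsq with rfl | rfl
  · refine Or.inl ⟨rfl, Set.pair_eq_pair_of_add_eq_add_of_mul_eq_mul ?_ hprod⟩
    exact mul_left_cancel₀ h₂ (by linear_combination hdiff)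
  · refine Or.inr (Set.pair_eq_pair_of_add_eq_add_of_mul_eq_mul ?_ ?_)
    · exact mul_left_cancel₀ h₅ (by linear_combination hdiff)
    · linear_combination -hprod
end

section
/- Let F be a field of characteristic different from 2 and let δ_1, ..., δ_6 ∈ F be such that δ_1, δ_2, δ_3 are pairwise distinct and δ_4, δ_5, δ_6 are pairwise distinct. Suppose the following three equations hold: (i) (δ_1 − δ_2)(δ_5 − δ_6) = (δ_2 − δ_3)(δ_4 − δ_5); (ii) (δ_1 − δ_2)(δ_5² − δ_6²) + (δ_1² − δ_2²)(δ_5 − δ_6) = (δ_2² − δ_3²)(δ_4 − δ_5) + (δ_2 − δ_3)(δ_4² − δ_5²); (iii) (δ_1² − δ_2²)(δ_5² − δ_6²) = (δ_2² − δ_3²)(δ_4² − δ_5²). Then δ_2 = δ_5 and {δ_1, δ_6} = {δ_3, δ_4} as sets. -/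
/-- Core algebraic lemma for the construction with evaluation points `δ + δ²γ` in odd
characteristic: if the three coefficient equations hold, then `δ_2 = δ_5` and
`{δ_1, δ_6} = {δ_3, δ_4}`. -/
theorem square_construction_algebraic_lemma {F : Type*} [Field F] (hchar : ringChar F ≠ 2)
    (δ₁ δ₂ δ₃ δ₄ δ₅ δ₆ : F)
    (h₁₂ : δ₁ ≠ δ₂) (h₁₃ : δ₁ ≠ δ₃) (h₂₃ : δ₂ ≠ δ₃)
    (h₄₅ : δ₄ ≠ δ₅) (h₄₆ : δ₄ ≠ δ₆) (h₅₆ : δ₅ ≠ δ₆)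
    (e₀ : (δ₁ - δ₂) * (δ₅ - δ₆) = (δ₂ - δ₃) * (δ₄ - δ₅))
    (e₁ : (δ₁ - δ₂) * (δ₅ ^ 2 - δ₆ ^ 2) + (δ₁ ^ 2 - δ₂ ^ 2) * (δ₅ - δ₆)
        = (δ₂ ^ 2 - δ₃ ^ 2) * (δ₄ - δ₅) + (δ₂ - δ₃) * (δ₄ ^ 2 - δ₅ ^ 2))
    (e₂ : (δ₁ ^ 2 - δ₂ ^ 2) * (δ₅ ^ 2 - δ₆ ^ 2) = (δ₂ ^ 2 - δ₃ ^ 2) * (δ₄ ^ 2 - δ₅ ^ 2)) :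
    δ₂ = δ₅ ∧ ({δ₁, δ₆} : Set F) = {δ₃, δ₄} := by
  have hc : (δ₁ - δ₂) * (δ₅ - δ₆) ≠ 0 := mul_ne_zero (sub_ne_zero.2 h₁₂) (sub_ne_zero.2 h₅₆)
  have hsum : δ₁ + δ₆ = δ₃ + δ₄ :=
    mul_left_cancel₀ hc (by linear_combination e₁ - (δ₂ + δ₃ + δ₄ + δ₅) * e₀)
  have hprod : (δ₁ + δ₂) * (δ₅ + δ₆) = (δ₂ + δ₃) * (δ₄ + δ₅) :=
    mul_left_cancel₀ hc (by linear_combination e₂ - (δ₂ + δ₃) * (δ₄ + δ₅) * e₀)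
  have h₁ : δ₁ + δ₂ = δ₄ + δ₅ :=
    mul_left_cancel₀ (sub_ne_zero.2 h₁₃)
      (by linear_combination (δ₁ + δ₂) * hsum - hprod)
  have h₂₅ : δ₂ = δ₅ :=
    mul_left_cancel₀ (mul_ne_zero (Ring.two_ne_zero hchar) (sub_ne_zero.2 h₄₆)) (by
      obtain rfl : δ₁ = δ₄ + δ₅ - δ₂ := by linear_combination h₁
      obtain rfl : δ₃ = δ₅ + δ₆ - δ₂ := by linear_combination -hsum
      linear_combination -e₀)
  subst h₂₅
  obtain rfl : δ₁ = δ₄ := add_right_cancel h₁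
  obtain rfl : δ₆ = δ₃ := by linear_combination hsum
  exact ⟨rfl, Set.pair_comm _ _⟩
end
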